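/- Let s>1, 0≤δ<1, 0<μ≤1, let λ:ℝ²→(0,∞), and let ψ:ℝ²→ℝ (variables (x,ξ)) be smooth and satisfy, for some C>0 and all k,l∈ℕ: |∂_x^{k}∂_ξ^{l}ψ(x,ξ)| ≤ C^{k+l+1}(k+l)!(1+(k+l)^{s-1}⟨ξ⟩_μ^{-δ})^{k+l} λ(x,ξ) ⟨ξ⟩_μ^{-l+δk}. Then there exist B>0 and C₂>0 such that for all i,j∈ℕ and all (x,ξ): |∂_ξ^{i}∂_x^{j}e^{ψ(x,ξ)}| ≤ C₂^{i+j}·(B·λ(x,ξ)+i+j+(i+j)^{s}⟨ξ⟩_μ^{-δ})^{i+j}·⟨ξ⟩_μ^{-i+δj}·e^{ψ(x,ξ)}; moreover, writing ω^{i}_{j}=e^{-ψ}∂_ξ^{i}∂_x^{j}e^{ψ}, there is C>0 such that for i+j≥1 and all k,l∈ℕ: |∂_ξ^{k}∂_x^{l}ω^{i}_{j}| ≤ C^{i+j+k+l}·B·λ·(B·λ+(i+j-1)+(i+j-1)^{s}⟨ξ⟩_μ^{-δ})^{i+j-1}·(k+l)!·(1+(k+l)^{s-1}⟨ξ⟩_μ^{-δ})^{k+l}·⟨ξ⟩_μ^{-(i+k)+δ(j+l)}.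 -/

import Mathlib

open scoped ContDiff

open Set

/-- `⟨ξ⟩_μ = (μ⁻² + ξ²)^(1/2)` -/
noncomputable def br (μ ξ : ℝ) : ℝ := Real.sqrt (μ⁻¹ ^ 2 + ξ ^ 2)

/-- `∂_x^k ∂_ξ^l f(x,ξ)` -/
noncomputable def pdXxi (k l : ℕ) (f : ℝ → ℝ → ℝ) (x ξ : ℝ) : ℝ :=
  iteratedDeriv k (fun x' => iteratedDeriv l (f x') ξ) x

/-- `∂_ξ^i ∂_x^j f(x,ξ)` -/
noncomputable def pdXiX (i j : ℕ) (f : ℝ → ℝ → ℝ) (x ξ : ℝ) : ℝ :=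
  iteratedDeriv i (fun ξ' => iteratedDeriv j (fun x' => f x' ξ') x) ξ

/-- `ω^i_j = e^{-ψ} ∂_ξ^i ∂_x^j e^{ψ}` -/
noncomputable def omg (ψ : ℝ → ℝ → ℝ) (i j : ℕ) (x ξ : ℝ) : ℝ :=
  Real.exp (-(ψ x ξ)) * pdXiX i j (fun x' ξ' => Real.exp (ψ x' ξ')) x ξ


/-- Partial derivative in the first variable. -/
noncomputable def DX (f : ℝ → ℝ → ℝ) : ℝ → ℝ → ℝ := fun x ξ => deriv (fun x' => f x' ξ) x

/-- Partial derivative in the second variable. -/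
noncomputable def DXi (f : ℝ → ℝ → ℝ) : ℝ → ℝ → ℝ := fun x ξ => deriv (fun ξ' => f x ξ') ξ

/-- Joint smoothness. -/
def Sm (f : ℝ → ℝ → ℝ) : Prop := ContDiff ℝ ∞ (Function.uncurry f)

lemma DX_eq {f : ℝ → ℝ → ℝ} (hf : Sm f) (x ξ : ℝ) :
    DX f x ξ = fderiv ℝ (Function.uncurry f) (x, ξ) (1, 0) := by
  have h1 : HasFDerivAt (Function.uncurry f) (fderiv ℝ (Function.uncurry f) (x, ξ)) (x, ξ) :=
    ((hf.differentiable (by simp)) (x, ξ)).hasFDerivAt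
  have h2 : HasDerivAt (fun x' : ℝ => (x', ξ)) ((1 : ℝ), (0 : ℝ)) x :=
    (hasDerivAt_id x).prodMk (hasDerivAt_const x ξ)
  exact (h1.comp_hasDerivAt x h2).deriv

lemma DXi_eq {f : ℝ → ℝ → ℝ} (hf : Sm f) (x ξ : ℝ) :
    DXi f x ξ = fderiv ℝ (Function.uncurry f) (x, ξ) (0, 1) := by
  have h1 : HasFDerivAt (Function.uncurry f) (fderiv ℝ (Function.uncurry f) (x, ξ)) (x, ξ) :=
    ((hf.differentiable (by simp)) (x, ξ)).hasFDerivAt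
  have h2 : HasDerivAt (fun ξ' : ℝ => (x, ξ')) ((0 : ℝ), (1 : ℝ)) ξ :=
    (hasDerivAt_const ξ x).prodMk (hasDerivAt_id ξ)
  exact (h1.comp_hasDerivAt ξ h2).deriv

lemma sm_fderiv {f : ℝ → ℝ → ℝ} (hf : Sm f) (v : ℝ × ℝ) :
    ContDiff ℝ ∞ (fun p : ℝ × ℝ => fderiv ℝ (Function.uncurry f) p v) :=
  (hf.fderiv_right (m := ∞) (by simp)).clm_apply contDiff_const

lemma Sm.DX {f : ℝ → ℝ → ℝ} (hf : Sm f) : Sm (DX f) := by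
  have : Function.uncurry (_root_.DX f) =
      fun p : ℝ × ℝ => fderiv ℝ (Function.uncurry f) p (1, 0) := by
    funext p; exact DX_eq hf p.1 p.2
  unfold Sm; rw [this]; exact sm_fderiv hf _

lemma Sm.DXi {f : ℝ → ℝ → ℝ} (hf : Sm f) : Sm (DXi f) := by
  have : Function.uncurry (_root_.DXi f) =
      fun p : ℝ × ℝ => fderiv ℝ (Function.uncurry f) p (0, 1) := by
    funext p; exact DXi_eq hf p.1 p.2
  unfold Sm; rw [this]; exact sm_fderiv hf _

lemma D_comm {f : ℝ → ℝ → ℝ} (hf : Sm f) : DX (DXi f) = DXi (DX f) := by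
  funext x ξ
  rw [DX_eq hf.DXi, DXi_eq hf.DX]
  have e1 : Function.uncurry (DXi f) =
      fun p : ℝ × ℝ => fderiv ℝ (Function.uncurry f) p (0, 1) := by
    funext p; exact DXi_eq hf p.1 p.2
  have e2 : Function.uncurry (DX f) =
      fun p : ℝ × ℝ => fderiv ℝ (Function.uncurry f) p (1, 0) := by
    funext p; exact DX_eq hf p.1 p.2
  rw [e1, e2]
  have hd : DifferentiableAt ℝ (fderiv ℝ (Function.uncurry f)) (x, ξ) :=
    ((hf.fderiv_right (m := ∞) (by simp)).differentiable (by simp)) _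
  have hsym : IsSymmSndFDerivAt ℝ (Function.uncurry f) (x, ξ) :=
    (hf.contDiffAt (x := (x, ξ))).isSymmSndFDerivAt (by simpa using (WithTop.coe_le_coe.2 le_top : ((2 : ℕ∞) : WithTop ℕ∞) ≤ ∞))
  rw [fderiv_clm_apply hd (differentiableAt_const _), fderiv_clm_apply hd (differentiableAt_const _)]
  simp
  exact hsym.eq (1, 0) (0, 1)

lemma Sm.iterX {f : ℝ → ℝ → ℝ} (hf : Sm f) (n : ℕ) : Sm (_root_.DX^[n] f) := by
  induction n with
  | zero => exact hf
  | succ n ih => rw [Function.iterate_succ_apply']; exact ih.DX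

lemma Sm.iterXi {f : ℝ → ℝ → ℝ} (hf : Sm f) (n : ℕ) : Sm (_root_.DXi^[n] f) := by
  induction n with
  | zero => exact hf
  | succ n ih => rw [Function.iterate_succ_apply']; exact ih.DXi

lemma DX_iterXi {f : ℝ → ℝ → ℝ} (hf : Sm f) (n : ℕ) : DX (DXi^[n] f) = DXi^[n] (DX f) := by
  induction n with
  | zero => rfl
  | succ n ih =>
    rw [Function.iterate_succ_apply', Function.iterate_succ_apply', D_comm (hf.iterXi n), ih]

lemma DXi_iterX {f : ℝ → ℝ → ℝ} (hf : Sm f) (n : ℕ) : DXi (DX^[n] f) = DX^[n] (DXi f) := by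
  induction n with
  | zero => rfl
  | succ n ih =>
    rw [Function.iterate_succ_apply', Function.iterate_succ_apply', ← D_comm (hf.iterX n), ih]

lemma iter_comm {f : ℝ → ℝ → ℝ} (hf : Sm f) (k l : ℕ) :
    DX^[k] (DXi^[l] f) = DXi^[l] (DX^[k] f) := by
  induction k with
  | zero => rfl
  | succ k ih =>
    rw [Function.iterate_succ_apply', Function.iterate_succ_apply', ih, DX_iterXi (hf.iterX k)]

lemma iteratedDeriv_X (f : ℝ → ℝ → ℝ) (n : ℕ) (ξ : ℝ) :
    iteratedDeriv n (fun x' => f x' ξ) = fun x => DX^[n] f x ξ := by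
  induction n with
  | zero => simp
  | succ n ih => rw [iteratedDeriv_succ, ih, Function.iterate_succ_apply']; rfl

lemma iteratedDeriv_Xi (f : ℝ → ℝ → ℝ) (n : ℕ) (x : ℝ) :
    iteratedDeriv n (fun ξ' => f x ξ') = fun ξ => DXi^[n] f x ξ := by
  induction n with
  | zero => simp
  | succ n ih => rw [iteratedDeriv_succ, ih, Function.iterate_succ_apply']; rfl

lemma pdXiX_eq (i j : ℕ) (f : ℝ → ℝ → ℝ) : pdXiX i j f = DXi^[i] (DX^[j] f) := by
  funext x ξ
  unfold pdXiX
  simp_rw [iteratedDeriv_X]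
  rw [iteratedDeriv_Xi]

lemma pdXxi_eq (i j : ℕ) (f : ℝ → ℝ → ℝ) : pdXxi i j f = DX^[i] (DXi^[j] f) := by
  funext x ξ
  unfold pdXxi
  have : ∀ x', iteratedDeriv j (f x') ξ = DXi^[j] f x' ξ := fun x' =>
    congrFun (iteratedDeriv_Xi f j x') ξ
  simp_rw [this]
  rw [iteratedDeriv_X]

lemma pd_comm {f : ℝ → ℝ → ℝ} (hf : Sm f) (i j : ℕ) : pdXxi j i f = pdXiX i j f := by
  rw [pdXiX_eq, pdXxi_eq, iter_comm hf]

lemma pdXiX_DXi {f : ℝ → ℝ → ℝ} (hf : Sm f) (i j : ℕ) :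
    pdXiX i j (DXi f) = pdXiX (i + 1) j f := by
  rw [pdXiX_eq, pdXiX_eq, Function.iterate_succ_apply, DXi_iterX hf]

lemma pdXiX_DX (f : ℝ → ℝ → ℝ) (i j : ℕ) :
    pdXiX i j (DX f) = pdXiX i (j + 1) f := by
  rw [pdXiX_eq, pdXiX_eq, Function.iterate_succ_apply]

lemma DXi_pdXiX (f : ℝ → ℝ → ℝ) (i j : ℕ) :
    DXi (pdXiX i j f) = pdXiX (i + 1) j f := by
  rw [pdXiX_eq, pdXiX_eq, Function.iterate_succ_apply']

lemma DX_pdXiX {f : ℝ → ℝ → ℝ} (hf : Sm f) (i j : ℕ) :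
    DX (pdXiX i j f) = pdXiX i (j + 1) f := by
  rw [pdXiX_eq, pdXiX_eq, DX_iterXi (hf.iterX j), Function.iterate_succ_apply']

lemma Sm.pdXiX {f : ℝ → ℝ → ℝ} (hf : Sm f) (i j : ℕ) : Sm (pdXiX i j f) := by
  rw [pdXiX_eq]; exact (hf.iterX j).iterXi i

lemma Sm.sliceX {f : ℝ → ℝ → ℝ} (hf : Sm f) (ξ : ℝ) : ContDiff ℝ ∞ (fun x => f x ξ) :=
  ContDiff.comp hf (contDiff_id.prodMk contDiff_const)

lemma Sm.sliceXi {f : ℝ → ℝ → ℝ} (hf : Sm f) (x : ℝ) : ContDiff ℝ ∞ (fun ξ => f x ξ) :=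
  ContDiff.comp (g := Function.uncurry f) (f := fun ξ : ℝ => (x, ξ)) hf
    (contDiff_const.prodMk contDiff_id)

lemma Sm.mul {f g : ℝ → ℝ → ℝ} (hf : Sm f) (hg : Sm g) : Sm (fun x ξ => f x ξ * g x ξ) :=
  ContDiff.mul hf hg

lemma Sm.add {f g : ℝ → ℝ → ℝ} (hf : Sm f) (hg : Sm g) : Sm (fun x ξ => f x ξ + g x ξ) :=
  ContDiff.add hf hg

lemma Sm.exp {f : ℝ → ℝ → ℝ} (hf : Sm f) : Sm (fun x ξ => Real.exp (f x ξ)) :=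
  ContDiff.exp hf

lemma Sm.neg {f : ℝ → ℝ → ℝ} (hf : Sm f) : Sm (fun x ξ => -(f x ξ)) :=
  ContDiff.neg hf

lemma pdXiX_add {f g : ℝ → ℝ → ℝ} (hf : Sm f) (hg : Sm g) (k l : ℕ) (x ξ : ℝ) :
    pdXiX k l (fun x ξ => f x ξ + g x ξ) x ξ = pdXiX k l f x ξ + pdXiX k l g x ξ := by
  have h1 : ∀ ξ', iteratedDeriv l (fun x' => f x' ξ' + g x' ξ') x =
      DX^[l] f x ξ' + DX^[l] g x ξ' := by
    intro ξ'
    rw [iteratedDeriv_fun_add ((hf.sliceX ξ').contDiffAt.of_le (by exact_mod_cast le_top))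
      ((hg.sliceX ξ').contDiffAt.of_le (by exact_mod_cast le_top)), iteratedDeriv_X, iteratedDeriv_X]
  rw [pdXiX_eq k l f, pdXiX_eq k l g]
  unfold pdXiX
  simp_rw [h1]
  rw [iteratedDeriv_fun_add (((hf.iterX l).sliceXi x).contDiffAt.of_le (by exact_mod_cast le_top))
      (((hg.iterX l).sliceXi x).contDiffAt.of_le (by exact_mod_cast le_top)),
      iteratedDeriv_Xi, iteratedDeriv_Xi]

lemma pdXiX_mul {f g : ℝ → ℝ → ℝ} (hf : Sm f) (hg : Sm g) (k l : ℕ) (x ξ : ℝ) :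
    pdXiX k l (fun x ξ => f x ξ * g x ξ) x ξ =
      ∑ b ∈ Finset.range (l + 1), ∑ a ∈ Finset.range (k + 1),
        (l.choose b : ℝ) * ((k.choose a : ℝ) * pdXiX a b f x ξ * pdXiX (k - a) (l - b) g x ξ) := by
  have h1 : ∀ ξ', iteratedDeriv l (fun x' => f x' ξ' * g x' ξ') x =
      ∑ b ∈ Finset.range (l + 1), (l.choose b : ℝ) * (DX^[b] f x ξ' * DX^[l - b] g x ξ') := by
    intro ξ'
    have := iteratedDeriv_mul (n := l) (x := x) (f := fun x' => f x' ξ') (g := fun x' => g x' ξ')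
      ((hf.sliceX ξ').contDiffAt.of_le (by exact_mod_cast le_top))
      ((hg.sliceX ξ').contDiffAt.of_le (by exact_mod_cast le_top))
    simp_rw [iteratedDeriv_X] at this
    refine Eq.trans this ?_
    exact Finset.sum_congr rfl fun b _ => by ring
  conv_lhs => unfold pdXiX
  simp_rw [h1]
  rw [iteratedDeriv_fun_sum]
  · refine Finset.sum_congr rfl fun b _ => ?_
    rw [← Finset.mul_sum, iteratedDeriv_const_mul_field]
    congr 1
    have := iteratedDeriv_mul (n := k) (x := ξ) (f := fun ξ' => DX^[b] f x ξ')
      (g := fun ξ' => DX^[l - b] g x ξ')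
      (((hf.iterX b).sliceXi x).contDiffAt.of_le (by exact_mod_cast le_top))
      (((hg.iterX (l - b)).sliceXi x).contDiffAt.of_le (by exact_mod_cast le_top))
    simp_rw [iteratedDeriv_Xi] at this
    simp_rw [pdXiX_eq]
    exact this
  · intro b _
    exact (contDiff_const.mul (((hf.iterX b).sliceXi x).mul
      ((hg.iterX (l - b)).sliceXi x))).contDiffAt.of_le (by exact_mod_cast le_top)

lemma omg_sm {ψ : ℝ → ℝ → ℝ} (hψ : Sm ψ) (i j : ℕ) : Sm (omg ψ i j) :=
  hψ.neg.exp.mul (hψ.exp.pdXiX i j)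

lemma omg_zero (ψ : ℝ → ℝ → ℝ) (x ξ : ℝ) : omg ψ 0 0 x ξ = 1 := by
  simp [omg, pdXiX, ← Real.exp_add]

lemma exp_eq_omg (ψ : ℝ → ℝ → ℝ) (i j : ℕ) (x ξ : ℝ) :
    pdXiX i j (fun x' ξ' => Real.exp (ψ x' ξ')) x ξ = Real.exp (ψ x ξ) * omg ψ i j x ξ := by
  unfold omg
  rw [← mul_assoc, ← Real.exp_add]; simp

lemma omg_succ_i {ψ : ℝ → ℝ → ℝ} (hψ : Sm ψ) (i j : ℕ) :
    omg ψ (i + 1) j = fun x ξ => DXi (omg ψ i j) x ξ + omg ψ i j x ξ * DXi ψ x ξ := by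
  funext x ξ
  have h1 : HasDerivAt (fun ξ' => ψ x ξ') (DXi ψ x ξ) ξ :=
    ((hψ.sliceXi x).differentiable (by simp) ξ).hasDerivAt
  have h2 : HasDerivAt (fun ξ' => pdXiX i j (fun x' ξ' => Real.exp (ψ x' ξ')) x ξ')
      (pdXiX (i + 1) j (fun x' ξ' => Real.exp (ψ x' ξ')) x ξ) ξ := by
    rw [← DXi_pdXiX]
    exact (((hψ.exp.pdXiX i j).sliceXi x).differentiable (by simp) ξ).hasDerivAt
  have h3 : DXi (omg ψ i j) x ξ = _ := (h1.neg.exp.mul h2).deriv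
  rw [h3]
  simp only [omg]
  simp
  ring

lemma omg_succ_j {ψ : ℝ → ℝ → ℝ} (hψ : Sm ψ) (i j : ℕ) :
    omg ψ i (j + 1) = fun x ξ => DX (omg ψ i j) x ξ + omg ψ i j x ξ * DX ψ x ξ := by
  funext x ξ
  have h1 : HasDerivAt (fun x' => ψ x' ξ) (DX ψ x ξ) x :=
    ((hψ.sliceX ξ).differentiable (by simp) x).hasDerivAt
  have h2 : HasDerivAt (fun y => pdXiX i j (fun x' ξ' => Real.exp (ψ x' ξ')) y ξ)
      (pdXiX i (j + 1) (fun x' ξ' => Real.exp (ψ x' ξ')) x ξ) x := by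
    rw [← DX_pdXiX hψ.exp]
    exact (((hψ.exp.pdXiX i j).sliceX ξ).differentiable (by simp) x).hasDerivAt
  have h3 : DX (omg ψ i j) x ξ = _ := (h1.neg.exp.mul h2).deriv
  rw [h3]
  simp only [omg]
  simp
  ring

/-- Majorant sequence. -/
def Qs (L : ℝ) (M : ℕ → ℝ) : ℕ → ℕ → ℝ
  | 0, n => L * M n
  | m + 1, n => Qs L M m (n + 1) + L * Qs L M m n

lemma Qs_nonneg {L : ℝ} {M : ℕ → ℝ} (hL : 0 ≤ L) (hM : ∀ n, 0 ≤ M n) (m n : ℕ) :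
    0 ≤ Qs L M m n := by
  induction m generalizing n with
  | zero => exact mul_nonneg hL (hM n)
  | succ m ih => exact add_nonneg (ih _) (mul_nonneg hL (ih _))

lemma Qs_conv {L : ℝ} {M : ℕ → ℝ} (hL : 0 ≤ L) (hM : ∀ n, 0 ≤ M n)
    (hc : ∀ n a, a ≤ n → (n.choose a : ℝ) * M a * M (n - a) ≤ M n) (m : ℕ) :
    ∀ n a, a ≤ n → (n.choose a : ℝ) * Qs L M m a * M (n - a) ≤ Qs L M m n := by
  induction m with
  | zero =>
    intro n a h
    have := mul_le_mul_of_nonneg_left (hc n a h) hL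
    simp only [Qs]
    linarith
  | succ m ih =>
    intro n a h
    have h1 := ih (n + 1) (a + 1) (by omega)
    have h2 := mul_le_mul_of_nonneg_left (ih n a h) hL
    have h3 : (n.choose a : ℝ) ≤ ((n + 1).choose (a + 1) : ℝ) := by
      rw [Nat.choose_succ_succ]; push_cast; linarith [Nat.cast_nonneg (α := ℝ) (n.choose (a+1))]
    have h4 : (n.choose a : ℝ) * Qs L M m (a + 1) * M (n - a) ≤ Qs L M m (n + 1) := by
      refine le_trans ?_ h1
      rw [Nat.add_sub_add_right]
      exact mul_le_mul_of_nonneg_right (mul_le_mul_of_nonneg_right h3 (Qs_nonneg hL hM _ _)) (hM _)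
    simp only [Qs]
    linarith

lemma Qs_bound {L Z R : ℝ} {M : ℕ → ℝ} (hL : 0 ≤ L) (n N : ℕ)
    (h : ∀ j ≤ N, M (n + j) ≤ Z ^ j * R) (m : ℕ) :
    ∀ j, m + j ≤ N → Qs L M m (n + j) ≤ L * Z ^ j * (L + Z) ^ m * R := by
  induction m with
  | zero =>
    intro j hj
    have := mul_le_mul_of_nonneg_left (h j (by omega)) hL
    simp only [Qs, pow_zero]; linarith
  | succ m ih =>
    intro j hj
    have h1 := ih (j + 1) (by omega)
    have h2 := mul_le_mul_of_nonneg_left (ih j (by omega)) hL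
    simp only [Qs]
    calc _ ≤ _ := add_le_add h1 h2
      _ = _ := by ring

lemma choose_mul_choose_le' (k l a b : ℕ) : k.choose a * l.choose b ≤ (k + l).choose (a + b) := by
  rw [Nat.add_choose_eq]
  exact Finset.single_le_sum (f := fun ij : ℕ × ℕ => k.choose ij.1 * l.choose ij.2)
    (fun _ _ => Nat.zero_le _) (Finset.HasAntidiagonal.mem_antidiagonal.2 rfl : (a, b) ∈ Finset.HasAntidiagonal.antidiagonal (a + b))

lemma sum_two_pow_le (k : ℕ) : ∑ a ∈ Finset.range (k + 1), (2 : ℝ) ^ a ≤ 2 * 2 ^ k := by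
  rw [geom_sum_eq (by norm_num)]
  rw [pow_succ]; norm_num; linarith

/-- Product estimate at a point. -/
lemma prod_bound {f g : ℝ → ℝ → ℝ} (hf : Sm f) (hg : Sm g) (x ξ u v L α β : ℝ)
    (A M : ℕ → ℝ) (hA : ∀ n, 0 ≤ A n) (hM : ∀ n, 0 ≤ M n) (hu : 0 < u) (hv : 0 < v)
    (hL : 0 ≤ L) (hα : 0 ≤ α) (hβ : 0 ≤ β)
    (hc : ∀ n a, a ≤ n → (n.choose a : ℝ) * A a * M (n - a) ≤ A n)
    (h1 : ∀ k l, |pdXiX k l f x ξ| ≤ α * 2 ^ (k + l) * A (k + l) * (u ^ k * v ^ l))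
    (h2 : ∀ k l, |pdXiX k l g x ξ| ≤ β * L * M (k + l) * (u ^ k * v ^ l)) (k l : ℕ) :
    |pdXiX k l (fun x ξ => f x ξ * g x ξ) x ξ| ≤
      4 * α * β * 2 ^ (k + l) * (L * A (k + l)) * (u ^ k * v ^ l) := by
  rw [pdXiX_mul hf hg]
  have key : ∀ b ∈ Finset.range (l + 1), ∀ a ∈ Finset.range (k + 1),
      |(l.choose b : ℝ) * ((k.choose a : ℝ) * pdXiX a b f x ξ * pdXiX (k - a) (l - b) g x ξ)| ≤
        2 ^ b * (2 ^ a * (α * β * L * A (k + l) * (u ^ k * v ^ l))) := by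
    intro b hb a ha
    have hb' : b ≤ l := by simpa [Nat.lt_succ_iff] using hb
    have ha' : a ≤ k := by simpa [Nat.lt_succ_iff] using ha
    rw [abs_mul, abs_mul, abs_mul, Nat.abs_cast, Nat.abs_cast]
    have hch : (k.choose a : ℝ) * (l.choose b : ℝ) ≤ ((k + l).choose (a + b) : ℝ) := by
      exact_mod_cast choose_mul_choose_le' k l a b
    have hcc := hc (k + l) (a + b) (by omega)
    have e : k + l - (a + b) = (k - a) + (l - b) := by omega
    rw [e] at hcc
    have eu : u ^ k = u ^ a * u ^ (k - a) := by rw [← pow_add]; congr 1; omega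
    have ev : v ^ l = v ^ b * v ^ (l - b) := by rw [← pow_add]; congr 1; omega
    have hA' := hA (a + b)
    have hM' := hM ((k - a) + (l - b))
    calc (l.choose b : ℝ) * ((k.choose a : ℝ) * |pdXiX a b f x ξ| * |pdXiX (k - a) (l - b) g x ξ|)
        ≤ (l.choose b : ℝ) * ((k.choose a : ℝ) * (α * 2 ^ (a + b) * A (a + b) * (u ^ a * v ^ b)) *
          (β * L * M ((k - a) + (l - b)) * (u ^ (k - a) * v ^ (l - b)))) := by
          gcongr
          · exact h1 a b
          · exact h2 _ _
      _ = ((k.choose a : ℝ) * (l.choose b : ℝ)) *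
          (A (a + b) * M ((k - a) + (l - b)) * (2 ^ b * 2 ^ a * (α * β * L * (u ^ k * v ^ l)))) := by
          rw [eu, ev, pow_add]; ring
      _ ≤ ((k + l).choose (a + b) : ℝ) *
          (A (a + b) * M ((k - a) + (l - b)) * (2 ^ b * 2 ^ a * (α * β * L * (u ^ k * v ^ l)))) := by
          gcongr
      _ = ((k + l).choose (a + b) * A (a + b) * M ((k - a) + (l - b))) *
          (2 ^ b * 2 ^ a * (α * β * L * (u ^ k * v ^ l))) := by ring
      _ ≤ A (k + l) * (2 ^ b * 2 ^ a * (α * β * L * (u ^ k * v ^ l))) := by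
          gcongr
      _ = _ := by ring
  refine (Finset.abs_sum_le_sum_abs _ _).trans ?_
  have hX : 0 ≤ α * β * L * A (k + l) * (u ^ k * v ^ l) := by
    have := hA (k + l); positivity
  calc _ ≤ ∑ b ∈ Finset.range (l + 1), ∑ a ∈ Finset.range (k + 1),
        (2 : ℝ) ^ b * (2 ^ a * (α * β * L * A (k + l) * (u ^ k * v ^ l))) :=
        Finset.sum_le_sum fun b hb => (Finset.abs_sum_le_sum_abs _ _).trans
          (Finset.sum_le_sum fun a ha => key b hb a ha)
    _ = (∑ b ∈ Finset.range (l + 1), (2 : ℝ) ^ b) * ((∑ a ∈ Finset.range (k + 1), (2 : ℝ) ^ a) *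
        (α * β * L * A (k + l) * (u ^ k * v ^ l))) := by
        simp_rw [← Finset.mul_sum, ← Finset.sum_mul]
    _ ≤ (2 * 2 ^ l) * ((2 * 2 ^ k) * (α * β * L * A (k + l) * (u ^ k * v ^ l))) := by
        gcongr
        · exact sum_two_pow_le l
        · exact sum_two_pow_le k
    _ = _ := by rw [pow_add]; ring

/-- The abstract bound for the derivatives of `omg`. -/
lemma omg_bound {ψ : ℝ → ℝ → ℝ} (hψ : Sm ψ) (x ξ u v L : ℝ) (M : ℕ → ℝ)
    (hM : ∀ n, 0 ≤ M n) (hu : 0 < u) (hv : 0 < v) (hL : 0 ≤ L)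
    (hc : ∀ n a, a ≤ n → (n.choose a : ℝ) * M a * M (n - a) ≤ M n)
    (h1 : ∀ k l, |pdXiX (k + 1) l ψ x ξ| ≤ L * M (k + l) * (u ^ (k + 1) * v ^ l))
    (h2 : ∀ k l, |pdXiX k (l + 1) ψ x ξ| ≤ L * M (k + l) * (u ^ k * v ^ (l + 1))) (m : ℕ) :
    ∀ i j, i + j = m + 1 → ∀ k l, |pdXiX k l (omg ψ i j) x ξ| ≤
      4 ^ m * 2 ^ (k + l) * Qs L M m (k + l) * (u ^ (i + k) * v ^ (j + l)) := by
  have hone : ∀ k l : ℕ, (1 : ℝ) ≤ 2 ^ (k + l) := fun k l => one_le_pow₀ (by norm_num)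
  induction m with
  | zero =>
    intro i j hij k l
    have hz : omg ψ 0 0 = fun _ _ => 1 := by funext x ξ; exact omg_zero ψ x ξ
    obtain ⟨rfl, rfl⟩ | ⟨rfl, rfl⟩ : (i = 1 ∧ j = 0) ∨ (i = 0 ∧ j = 1) := by omega
    · have e : omg ψ 1 0 = DXi ψ := by
        rw [omg_succ_i hψ 0 0, hz]; funext x ξ; simp [DXi]
      rw [e, pdXiX_DXi hψ]
      refine (h1 k l).trans ?_
      have := hM (k + l)
      have h0 : 0 ≤ L * M (k + l) * (u ^ (k + 1) * v ^ l) := by positivity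
      simp only [Qs, pow_zero, one_mul, zero_add, add_comm 1 k]
      nlinarith [mul_le_mul_of_nonneg_right (hone k l) h0]
    · have e : omg ψ 0 1 = DX ψ := by
        rw [omg_succ_j hψ 0 0, hz]; funext x ξ; simp [DX]
      rw [e, pdXiX_DX]
      refine (h2 k l).trans ?_
      have := hM (k + l)
      have h0 : 0 ≤ L * M (k + l) * (u ^ k * v ^ (l + 1)) := by positivity
      simp only [Qs, pow_zero, one_mul, zero_add, add_comm 1 l]
      nlinarith [mul_le_mul_of_nonneg_right (hone k l) h0]
  | succ m ih =>
    intro i j hij k l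
    have hQ := Qs_nonneg hL hM m
    have hQc := Qs_conv hL hM hc m
    have hcase : (∃ i', i = i' + 1 ∧ i' + j = m + 1) ∨ (∃ j', j = j' + 1 ∧ i + j' = m + 1) := by
      rcases i with _ | i'
      · right; exact ⟨j - 1, by omega, by omega⟩
      · left; exact ⟨i', rfl, by omega⟩
    rcases hcase with ⟨i', rfl, h⟩ | ⟨j', rfl, h⟩
    · rw [omg_succ_i hψ, pdXiX_add (omg_sm hψ _ _).DXi ((omg_sm hψ _ _).mul hψ.DXi),
        pdXiX_DXi (omg_sm hψ _ _)]
      have b1 := ih i' j h (k + 1) l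
      have b2 := prod_bound (omg_sm hψ i' j) hψ.DXi x ξ u v L (4 ^ m * (u ^ i' * v ^ j)) u
        (Qs L M m) M hQ hM hu hv hL (by positivity) hu.le hQc
        (fun k l => (ih i' j h k l).trans (le_of_eq (by rw [pow_add u, pow_add v]; ring)))
        (fun k l => by rw [pdXiX_DXi hψ]; exact (h1 k l).trans (le_of_eq (by ring))) k l
      refine (abs_add_le _ _).trans ((add_le_add b1 b2).trans ?_)
      have e : k + 1 + l = k + l + 1 := by ring
      rw [e]
      have q1 := hQ (k + l + 1)
      have h0 : 0 ≤ 4 ^ m * 2 ^ (k + l) * Qs L M m (k + l + 1) * (u ^ (i' + 1 + k) * v ^ (j + l)) := by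
        positivity
      simp only [Qs]
      have e2 : u ^ (i' + (k + 1)) = u ^ (i' + 1 + k) := by congr 1; ring
      rw [e2]
      have e3 : 4 * (4 ^ m * (u ^ i' * v ^ j)) * u * 2 ^ (k + l) * (L * Qs L M m (k + l)) * (u ^ k * v ^ l)
        = 4 ^ (m + 1) * 2 ^ (k + l) * (L * Qs L M m (k + l)) * (u ^ (i' + 1 + k) * v ^ (j + l)) := by
        ring
      rw [e3, pow_succ 2, pow_succ 4]
      nlinarith
    · rw [omg_succ_j hψ, pdXiX_add (omg_sm hψ _ _).DX ((omg_sm hψ _ _).mul hψ.DX),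
        pdXiX_DX]
      have b1 := ih i j' h k (l + 1)
      have b2 := prod_bound (omg_sm hψ i j') hψ.DX x ξ u v L (4 ^ m * (u ^ i * v ^ j')) v
        (Qs L M m) M hQ hM hu hv hL (by positivity) hv.le hQc
        (fun k l => (ih i j' h k l).trans (le_of_eq (by rw [pow_add u, pow_add v]; ring)))
        (fun k l => by rw [pdXiX_DX]; exact (h2 k l).trans (le_of_eq (by ring))) k l
      refine (abs_add_le _ _).trans ((add_le_add b1 b2).trans ?_)
      have e : k + (l + 1) = k + l + 1 := by ring
      rw [e]
      have q1 := hQ (k + l + 1)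
      have h0 : 0 ≤ 4 ^ m * 2 ^ (k + l) * Qs L M m (k + l + 1) * (u ^ (i + k) * v ^ (j' + 1 + l)) := by
        positivity
      simp only [Qs]
      have e2 : v ^ (j' + (l + 1)) = v ^ (j' + 1 + l) := by congr 1; ring
      rw [e2]
      have e3 : 4 * (4 ^ m * (u ^ i * v ^ j')) * v * 2 ^ (k + l) * (L * Qs L M m (k + l)) * (u ^ k * v ^ l)
        = 4 ^ (m + 1) * 2 ^ (k + l) * (L * Qs L M m (k + l)) * (u ^ (i + k) * v ^ (j' + 1 + l)) := by
        ring
      rw [e3, pow_succ 2, pow_succ 4]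
      nlinarith

/-- The Gevrey-type sequence `n! (1 + n^(s-1) t)^n`. -/
noncomputable def gM (s t : ℝ) (n : ℕ) : ℝ :=
  (n.factorial : ℝ) * (1 + (n : ℝ) ^ (s - 1) * t) ^ n

lemma gM_pos {s t : ℝ} (ht : 0 < t) (n : ℕ) : 0 < gM s t n := by
  unfold gM
  have : (0 : ℝ) ≤ (n : ℝ) ^ (s - 1) := by positivity
  positivity

lemma gM_conv {s t : ℝ} (hs : 1 < s) (ht : 0 < t) (n a : ℕ) (h : a ≤ n) :
    (n.choose a : ℝ) * gM s t a * gM s t (n - a) ≤ gM s t n := by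
  unfold gM
  have hf : (n.choose a : ℝ) * (a.factorial : ℝ) * ((n - a).factorial : ℝ) = n.factorial := by
    exact_mod_cast Nat.choose_mul_factorial_mul_factorial h
  have m1 : (a : ℝ) ^ (s - 1) ≤ (n : ℝ) ^ (s - 1) :=
    Real.rpow_le_rpow (by positivity) (by exact_mod_cast h) (by linarith)
  have m2 : ((n - a : ℕ) : ℝ) ^ (s - 1) ≤ (n : ℝ) ^ (s - 1) :=
    Real.rpow_le_rpow (by positivity) (by exact_mod_cast Nat.sub_le n a) (by linarith)
  have p1 : (0 : ℝ) ≤ (a : ℝ) ^ (s - 1) := by positivity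
  have p2 : (0 : ℝ) ≤ ((n - a : ℕ) : ℝ) ^ (s - 1) := by positivity
  have p3 : (0 : ℝ) ≤ (n : ℝ) ^ (s - 1) := by positivity
  calc _ = ((n.choose a : ℝ) * (a.factorial : ℝ) * ((n - a).factorial : ℝ)) *
      ((1 + (a : ℝ) ^ (s - 1) * t) ^ a * (1 + ((n - a : ℕ) : ℝ) ^ (s - 1) * t) ^ (n - a)) := by ring
    _ ≤ (n.factorial : ℝ) *
      ((1 + (n : ℝ) ^ (s - 1) * t) ^ a * (1 + (n : ℝ) ^ (s - 1) * t) ^ (n - a)) := by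
      rw [hf]; gcongr
    _ = _ := by rw [← pow_add]; congr 3; omega

lemma one_side {s t : ℝ} (hs : 1 < s) (ht : 0 < t) (a b : ℕ) :
    (1 + ((a + b : ℕ) : ℝ) ^ (s - 1) * t) ^ a ≤
      Real.exp (s - 1) ^ b * (1 + (a : ℝ) ^ (s - 1) * t) ^ a := by
  rcases Nat.eq_zero_or_pos a with rfl | ha
  · simp only [pow_zero, mul_one]
    exact one_le_pow₀ (Real.one_le_exp (by linarith))
  · have ha' : (0 : ℝ) < a := by exact_mod_cast ha
    have e1 : ((a + b : ℕ) : ℝ) ≤ a * Real.exp ((b : ℝ) / a) := by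
      have := Real.add_one_le_exp ((b : ℝ) / a)
      calc ((a + b : ℕ) : ℝ) = a * ((b : ℝ) / a + 1) := by push_cast; field_simp; ring
        _ ≤ _ := by gcongr
    have e2 : ((a + b : ℕ) : ℝ) ^ (s - 1) ≤ (a : ℝ) ^ (s - 1) * Real.exp ((b : ℝ) / a * (s - 1)) := by
      refine (Real.rpow_le_rpow (by positivity) e1 (by linarith)).trans (le_of_eq ?_)
      rw [Real.mul_rpow ha'.le (Real.exp_pos _).le, ← Real.exp_mul]
    have e3 : 1 ≤ Real.exp ((b : ℝ) / a * (s - 1)) := by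
      apply Real.one_le_exp
      have : 0 ≤ s - 1 := by linarith
      positivity
    have p1 : (0 : ℝ) ≤ (a : ℝ) ^ (s - 1) := by positivity
    have e4 : 1 + ((a + b : ℕ) : ℝ) ^ (s - 1) * t ≤
        Real.exp ((b : ℝ) / a * (s - 1)) * (1 + (a : ℝ) ^ (s - 1) * t) := by
      nlinarith [mul_le_mul_of_nonneg_right e2 ht.le]
    have e5 : Real.exp ((b : ℝ) / a * (s - 1)) ^ a = Real.exp (s - 1) ^ b := by
      rw [← Real.exp_nat_mul, ← Real.exp_nat_mul]; congr 1; field_simp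
    calc _ ≤ (Real.exp ((b : ℝ) / a * (s - 1)) * (1 + (a : ℝ) ^ (s - 1) * t)) ^ a := by
          gcongr
      _ = _ := by rw [mul_pow, e5]

lemma gM_split {s t : ℝ} (hs : 1 < s) (ht : 0 < t) (a b : ℕ) :
    gM s t (a + b) ≤ (2 * Real.exp (s - 1)) ^ (a + b) * (gM s t a * gM s t b) := by
  have h1 := one_side hs ht a b
  have h2 := one_side hs ht b a
  rw [add_comm b a] at h2
  have hf : ((a + b).factorial : ℝ) ≤ 2 ^ (a + b) * (a.factorial * b.factorial) := by
    have e : ((a + b).choose a : ℝ) * a.factorial * b.factorial = (a + b).factorial := by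
      have := Nat.choose_mul_factorial_mul_factorial (Nat.le_add_right a b)
      rw [Nat.add_sub_cancel_left] at this
      exact_mod_cast this
    have c : ((a + b).choose a : ℝ) ≤ 2 ^ (a + b) := by exact_mod_cast Nat.choose_le_two_pow _ _
    rw [← e, mul_assoc]
    gcongr
  have p1 : (0 : ℝ) ≤ (a : ℝ) ^ (s - 1) := by positivity
  have p2 : (0 : ℝ) ≤ (b : ℝ) ^ (s - 1) := by positivity
  have p3 : (0 : ℝ) ≤ ((a + b : ℕ) : ℝ) ^ (s - 1) := by positivity
  unfold gM
  calc ((a + b).factorial : ℝ) * (1 + ((a + b : ℕ) : ℝ) ^ (s - 1) * t) ^ (a + b)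
      = ((a + b).factorial : ℝ) * ((1 + ((a + b : ℕ) : ℝ) ^ (s - 1) * t) ^ a *
        (1 + ((a + b : ℕ) : ℝ) ^ (s - 1) * t) ^ b) := by rw [pow_add _ a b]
    _ ≤ (2 ^ (a + b) * (a.factorial * b.factorial)) *
        ((Real.exp (s - 1) ^ b * (1 + (a : ℝ) ^ (s - 1) * t) ^ a) *
        (Real.exp (s - 1) ^ a * (1 + (b : ℝ) ^ (s - 1) * t) ^ b)) := by
        gcongr
    _ = _ := by rw [mul_pow, pow_add (Real.exp (s - 1))]; ring

lemma gM_le {s t : ℝ} (hs : 1 < s) (ht : 0 < t) (j N : ℕ) (h : j ≤ N) :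
    gM s t j ≤ ((N : ℝ) + (N : ℝ) ^ s * t) ^ j := by
  have e : (N : ℝ) + (N : ℝ) ^ s * t = N * (1 + (N : ℝ) ^ (s - 1) * t) := by
    have : (N : ℝ) ^ s = N * (N : ℝ) ^ (s - 1) := by
      rcases Nat.eq_zero_or_pos N with rfl | hN
      · simp [Real.zero_rpow (by linarith : s ≠ 0)]
      · have hN' : (0 : ℝ) < N := by exact_mod_cast hN
        rw [Real.rpow_sub_one hN'.ne']; field_simp
    rw [this]; ring
  have p1 : (0 : ℝ) ≤ (j : ℝ) ^ (s - 1) := by positivity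
  have m1 : (j : ℝ) ^ (s - 1) ≤ (N : ℝ) ^ (s - 1) :=
    Real.rpow_le_rpow (by positivity) (by exact_mod_cast h) (by linarith)
  have f1 : (j.factorial : ℝ) ≤ (N : ℝ) ^ j := by
    calc (j.factorial : ℝ) ≤ (j : ℝ) ^ j := by exact_mod_cast Nat.factorial_le_pow j
      _ ≤ _ := by gcongr
  rw [e, mul_pow]
  unfold gM
  gcongr

lemma weight_eq {b δ : ℝ} (hb : 0 < b) (i j : ℕ) :
    (b⁻¹) ^ i * (b ^ δ) ^ j = b ^ (-(i : ℝ) + δ * (j : ℝ)) := by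
  rw [Real.rpow_add hb, Real.rpow_neg hb.le, Real.rpow_natCast, Real.rpow_mul hb.le,
    Real.rpow_natCast, inv_pow]

lemma one_le_br {μ : ℝ} (h0 : 0 < μ) (h1 : μ ≤ 1) (ξ : ℝ) : 1 ≤ br μ ξ := by
  unfold br
  rw [Real.one_le_sqrt]
  have : 1 ≤ μ⁻¹ := (one_le_inv₀ h0).2 h1
  nlinarith [sq_nonneg ξ]

theorem stmt11 (s δ μ : ℝ) (hs : 1 < s) (hδ0 : 0 ≤ δ) (hδ1 : δ < 1)
    (hμ0 : 0 < μ) (hμ1 : μ ≤ 1)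
    (lam : ℝ → ℝ → ℝ) (hlam : ∀ x ξ, 0 < lam x ξ)
    (ψ : ℝ → ℝ → ℝ) (hψsmooth : ContDiff ℝ ∞ (Function.uncurry ψ))
    (C : ℝ) (hC : 0 < C)
    (hψ : ∀ (k l : ℕ) (x ξ : ℝ),
      |pdXxi k l ψ x ξ| ≤
        C ^ (k + l + 1) * ((k + l).factorial : ℝ) *
          (1 + ((k + l : ℕ) : ℝ) ^ (s - 1) * br μ ξ ^ (-δ)) ^ (k + l) *
          lam x ξ * br μ ξ ^ (-(l : ℝ) + δ * (k : ℝ))) :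
    ∃ B C₂ : ℝ, 0 < B ∧ 0 < C₂ ∧
      (∀ (i j : ℕ) (x ξ : ℝ),
        |pdXiX i j (fun x' ξ' => Real.exp (ψ x' ξ')) x ξ| ≤
          C₂ ^ (i + j) *
            (B * lam x ξ + ((i + j : ℕ) : ℝ) + ((i + j : ℕ) : ℝ) ^ s * br μ ξ ^ (-δ)) ^ (i + j) *
            br μ ξ ^ (-(i : ℝ) + δ * (j : ℝ)) * Real.exp (ψ x ξ)) ∧
      ∃ C' : ℝ, 0 < C' ∧
        ∀ (i j k l : ℕ), 1 ≤ i + j → ∀ (x ξ : ℝ),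
          |pdXiX k l (omg ψ i j) x ξ| ≤
            C' ^ (i + j + k + l) * B * lam x ξ *
              (B * lam x ξ + ((i + j - 1 : ℕ) : ℝ)
                + ((i + j - 1 : ℕ) : ℝ) ^ s * br μ ξ ^ (-δ)) ^ (i + j - 1) *
              ((k + l).factorial : ℝ) *
              (1 + ((k + l : ℕ) : ℝ) ^ (s - 1) * br μ ξ ^ (-δ)) ^ (k + l) *
              br μ ξ ^ (-((i : ℝ) + (k : ℝ)) + δ * ((j : ℝ) + (l : ℝ))) := by
  have hψ0 : Sm ψ := hψsmooth
  set F : ℝ := 2 * Real.exp (s - 1) with hF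
  have hF1 : 1 ≤ F := by
    have := Real.one_le_exp (show (0 : ℝ) ≤ s - 1 by linarith)
    rw [hF]; linarith
  have hF0 : 0 < F := by linarith
  set K : ℝ := (C + 1) * F with hK
  have hK1 : 1 ≤ K := by rw [hK]; nlinarith
  have hK0 : 0 < K := by linarith
  set B : ℝ := 2 * C ^ 2 * F with hB
  have hB0 : 0 < B := by positivity
  have hKF1 : 1 ≤ K * F := by nlinarith
  have main : ∀ (m i j : ℕ), i + j = m + 1 → ∀ (k l : ℕ) (x ξ : ℝ),
      |pdXiX k l (omg ψ i j) x ξ| ≤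
        (4 * (K * F)) ^ (m + 1 + k + l) * (B * lam x ξ) *
          (B * lam x ξ + ((m : ℝ) + (m : ℝ) ^ s * br μ ξ ^ (-δ))) ^ m *
          gM s (br μ ξ ^ (-δ)) (k + l) *
          br μ ξ ^ (-((i + k : ℕ) : ℝ) + δ * ((j + l : ℕ) : ℝ)) := by
    intro m i j hij k l x ξ
    have hb1 := one_le_br hμ0 hμ1 ξ
    have hb0 : 0 < br μ ξ := by linarith
    have hlam0 := hlam x ξ
    set t : ℝ := br μ ξ ^ (-δ) with ht
    have ht0 : 0 < t := Real.rpow_pos_of_pos hb0 _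
    have ht1 : t ≤ 1 := Real.rpow_le_one_of_one_le_of_nonpos hb1 (by linarith)
    have hL0 : 0 < B * lam x ξ := by positivity
    set L : ℝ := B * lam x ξ with hL
    have hgp := gM_pos (s := s) ht0
    let M : ℕ → ℝ := fun n => K ^ n * gM s t n
    have hM : ∀ n, 0 ≤ M n := fun n => mul_nonneg (by positivity) (hgp n).le
    have hc : ∀ n a, a ≤ n → (n.choose a : ℝ) * M a * M (n - a) ≤ M n := by
      intro n a h
      have e : K ^ n = K ^ a * K ^ (n - a) := by rw [← pow_add]; congr 1; omega
      calc (n.choose a : ℝ) * (K ^ a * gM s t a) * (K ^ (n - a) * gM s t (n - a))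
          = K ^ n * ((n.choose a : ℝ) * gM s t a * gM s t (n - a)) := by rw [e]; ring
        _ ≤ _ := mul_le_mul_of_nonneg_left (gM_conv hs ht0 n a h) (by positivity)
    have hstep : ∀ n, C ^ (n + 1 + 1) * gM s t (n + 1) * lam x ξ ≤ L * M n := by
      intro n
      have h1 := gM_split hs ht0 n 1
      have h2 : gM s t 1 ≤ 2 := by simp [gM]; linarith
      have hg := hgp n
      calc C ^ (n + 1 + 1) * gM s t (n + 1) * lam x ξ
          ≤ C ^ (n + 1 + 1) * (F ^ (n + 1) * (gM s t n * 2)) * lam x ξ := by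
            gcongr
            exact h1.trans (by gcongr)
        _ = C ^ n * (F ^ n * (B * lam x ξ * gM s t n)) := by rw [hB]; ring
        _ ≤ (C + 1) ^ n * (F ^ n * (B * lam x ξ * gM s t n)) := by
            gcongr
            linarith
        _ = _ := by simp only [M, hK, hL, mul_pow]; ring
    have hder : ∀ n k l, k + l = n + 1 →
        |pdXiX k l ψ x ξ| ≤ L * M n * ((br μ ξ)⁻¹ ^ k * (br μ ξ ^ δ) ^ l) := by
      intro n k l hkl
      rw [weight_eq hb0, ← pd_comm hψ0]
      have h := hψ l k x ξ
      rw [show l + k = n + 1 by omega] at h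
      refine h.trans ?_
      have hw : 0 ≤ br μ ξ ^ (-(k : ℝ) + δ * (l : ℝ)) := (Real.rpow_pos_of_pos hb0 _).le
      refine le_trans (le_of_eq ?_) (mul_le_mul_of_nonneg_right (hstep n) hw)
      simp only [gM]; ring
    have hob := omg_bound hψ0 x ξ (br μ ξ)⁻¹ (br μ ξ ^ δ) L M hM (by positivity)
      (Real.rpow_pos_of_pos hb0 _) hL0.le hc
      (fun k l => hder (k + l) (k + 1) l (by omega))
      (fun k l => hder (k + l) k (l + 1) (by omega)) m i j hij k l
    rw [weight_eq hb0] at hob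
    refine hob.trans ?_
    have hw : 0 ≤ br μ ξ ^ (-((i + k : ℕ) : ℝ) + δ * ((j + l : ℕ) : ℝ)) :=
      (Real.rpow_pos_of_pos hb0 _).le
    refine mul_le_mul_of_nonneg_right ?_ hw
    have hZ0 : 0 ≤ (m : ℝ) + (m : ℝ) ^ s * t := by
      have : (0 : ℝ) ≤ (m : ℝ) ^ s := by positivity
      positivity
    set Z : ℝ := (m : ℝ) + (m : ℝ) ^ s * t with hZ
    set n := k + l with hn
    have hg := hgp n
    have hMb : ∀ j ≤ m, M (n + j) ≤ Z ^ j * ((K * F) ^ (m + n) * gM s t n) := by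
      intro j hj
      have h1 := gM_split hs ht0 n j
      have h2 := gM_le hs ht0 j m hj
      calc M (n + j) ≤ K ^ (n + j) * (F ^ (n + j) * (gM s t n * Z ^ j)) := by
            refine mul_le_mul_of_nonneg_left (h1.trans ?_) (by positivity)
            gcongr
        _ = (K * F) ^ (n + j) * (gM s t n * Z ^ j) := by rw [mul_pow K F]; ring
        _ ≤ (K * F) ^ (m + n) * (gM s t n * Z ^ j) := by
            have : (K * F) ^ (n + j) ≤ (K * F) ^ (m + n) := pow_le_pow_right₀ hKF1 (by omega)
            gcongr
        _ = _ := by ring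
    have hQ := Qs_bound hL0.le n m hMb m 0 (by omega)
    rw [add_zero, pow_zero, mul_one] at hQ
    have hc2 : (4 : ℝ) ^ m * 2 ^ n * (K * F) ^ (m + n) ≤ (4 * (K * F)) ^ (m + 1 + k + l) := by
      calc (4 : ℝ) ^ m * 2 ^ n * (K * F) ^ (m + n) ≤ 4 ^ m * 4 ^ n * (K * F) ^ (m + n) := by
            gcongr; norm_num
        _ = (4 * (K * F)) ^ (m + n) := by rw [← pow_add, ← mul_pow]
        _ ≤ _ := pow_le_pow_right₀ (by linarith) (by omega)
    calc 4 ^ m * 2 ^ n * Qs L M m n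
        ≤ 4 ^ m * 2 ^ n * (L * (L + Z) ^ m * ((K * F) ^ (m + n) * gM s t n)) := by gcongr
      _ = (4 ^ m * 2 ^ n * (K * F) ^ (m + n)) * (L * (L + Z) ^ m * gM s t n) := by ring
      _ ≤ (4 * (K * F)) ^ (m + 1 + k + l) * (L * (L + Z) ^ m * gM s t n) := by gcongr
      _ = _ := by ring
  have hC' : 0 < 4 * (K * F) := by positivity
  refine ⟨B, 4 * (K * F), hB0, hC', ?_, 4 * (K * F), hC', ?_⟩
  · intro i j x ξ
    rcases Nat.eq_zero_or_pos (i + j) with h | h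
    · obtain ⟨rfl, rfl⟩ : i = 0 ∧ j = 0 := by omega
      simp [pdXiX]
    · obtain ⟨m, hm⟩ : ∃ m, i + j = m + 1 := ⟨i + j - 1, by omega⟩
      have h1 := main m i j hm 0 0 x ξ
      have e0 : pdXiX 0 0 (omg ψ i j) x ξ = omg ψ i j x ξ := by simp [pdXiX]
      have hb0 : 0 < br μ ξ := by linarith [one_le_br hμ0 hμ1 ξ]
      have ht0 : 0 < br μ ξ ^ (-δ) := Real.rpow_pos_of_pos hb0 _
      have hw : 0 < br μ ξ ^ (-(i : ℝ) + δ * (j : ℝ)) := Real.rpow_pos_of_pos hb0 _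
      have hlam0 := hlam x ξ
      have hg0 : gM s (br μ ξ ^ (-δ)) 0 = 1 := by simp [gM]
      rw [e0] at h1
      simp only [add_zero, hg0, mul_one] at h1
      rw [exp_eq_omg, abs_mul, abs_of_pos (Real.exp_pos _), mul_comm, hm]
      refine mul_le_mul_of_nonneg_right (h1.trans (mul_le_mul_of_nonneg_right ?_ hw.le))
        (Real.exp_pos _).le
      set t := br μ ξ ^ (-δ)
      have p1 : (0 : ℝ) ≤ (m : ℝ) ^ s := by positivity
      have p2 : (0 : ℝ) ≤ ((m + 1 : ℕ) : ℝ) ^ s := by positivity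
      have q1 : B * lam x ξ + ((m : ℝ) + (m : ℝ) ^ s * t) ≤
          B * lam x ξ + ((m + 1 : ℕ) : ℝ) + ((m + 1 : ℕ) : ℝ) ^ s * t := by
        have a1 : (m : ℝ) ≤ ((m + 1 : ℕ) : ℝ) := by push_cast; linarith
        have a2 : (m : ℝ) ^ s ≤ ((m + 1 : ℕ) : ℝ) ^ s :=
          Real.rpow_le_rpow (by positivity) a1 (by linarith)
        nlinarith [mul_le_mul_of_nonneg_right a2 ht0.le]
      have q2 : B * lam x ξ ≤
          B * lam x ξ + ((m + 1 : ℕ) : ℝ) + ((m + 1 : ℕ) : ℝ) ^ s * t := by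
        have : (0 : ℝ) ≤ ((m + 1 : ℕ) : ℝ) := by positivity
        nlinarith [mul_nonneg p2 ht0.le]
      rw [mul_assoc, pow_succ' (B * lam x ξ + ((m + 1 : ℕ) : ℝ) + ((m + 1 : ℕ) : ℝ) ^ s * t)]
      have q0 : 0 ≤ B * lam x ξ + ((m : ℝ) + (m : ℝ) ^ s * t) := by positivity
      gcongr
  · intro i j k l hij x ξ
    obtain ⟨m, hm⟩ : ∃ m, i + j = m + 1 := ⟨i + j - 1, by omega⟩
    have h1 := main m i j hm k l x ξ
    rw [hm, Nat.add_sub_cancel]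
    refine h1.trans (le_of_eq ?_)
    simp only [gM]
    push_cast
    ring
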